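/- Let Y(z) = (1/4)·tanh(z/4) (i.e. solution of Y' + Y^2 = 1/16, the Riccati equation with a = 0, b = 1/16). Then y(z) = C₀ + 3/2 - (15/8)(U + U⁻¹) - (15/4)(U² + U⁻²) + (15/8)(U³ + U⁻³), with U(z) = tanh(z/4), satisfies the travelling-wave Kuramoto–Sivashinsky equation C₁ - C₀·y + y' + σ·y'' + y''' + (1/2)y² = 0 with σ = 4 and C₁ = (1/2)C₀² - 18, at all points z ≠ 0. -/

import Mathlib

theorem ks_tanh_deriv (z : ℝ) :
    HasDerivAt (fun z : ℝ => Real.tanh (z/4)) ((1 - Real.tanh (z/4)^2)/4) z := by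
  have h4 : HasDerivAt (fun z : ℝ => z/4) (1/4) z := (hasDerivAt_id z).div_const 4
  have hc : Real.cosh (z/4) ≠ 0 := (Real.cosh_pos _).ne'
  have h := (h4.sinh).div (h4.cosh) hc
  have e : (fun z : ℝ => Real.tanh (z/4)) = (fun z => Real.sinh (z/4)) / (fun z => Real.cosh (z/4)) := by
    funext x
    simp [Real.tanh_eq_sinh_div_cosh]
  rw [e]
  refine h.congr_deriv ?_
  rw [Real.tanh_eq_sinh_div_cosh]
  field_simp

theorem ks_tanh_ne (z : ℝ) (hz : z ≠ 0) : Real.tanh (z/4) ≠ 0 := by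
  rw [Real.tanh_eq_sinh_div_cosh]
  refine div_ne_zero ?_ (Real.cosh_pos _).ne'
  rw [Ne, Real.sinh_eq_zero]
  intro h
  apply hz
  linarith

theorem ks_coth_deriv (z : ℝ) (hz : z ≠ 0) :
    HasDerivAt (fun z : ℝ => (Real.tanh (z/4))⁻¹) ((1 - (Real.tanh (z/4))⁻¹^2)/4) z := by
  have h := (ks_tanh_deriv z).fun_inv (ks_tanh_ne z hz)
  have := ks_tanh_ne z hz
  refine h.congr_deriv ?_
  field_simp
  ring

/-- Derivative of a degree-five polynomial in a solution of the Riccati equation. -/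
theorem ks_poly_deriv (T : ℝ → ℝ) (z : ℝ) (h : HasDerivAt T ((1 - T z^2)/4) z)
    (a b c d e : ℝ) :
    HasDerivAt (fun z => a * T z + b * T z^2 + c * T z^3 + d * T z^4 + e * T z^5)
      ((a + 2*b*T z + 3*c*T z^2 + 4*d*T z^3 + 5*e*T z^4) * ((1 - T z^2)/4)) z := by
  have h' := ((((h.const_mul a).add ((h.fun_pow 2).const_mul b)).add
    ((h.fun_pow 3).const_mul c)).add ((h.fun_pow 4).const_mul d)).add ((h.fun_pow 5).const_mul e)
  refine h'.congr_deriv ?_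
  push_cast
  ring

/-- The derivative, off zero, of a symmetric polynomial expression in tanh and coth. -/
theorem ks_sym_deriv (k a b c d e : ℝ) (f : ℝ → ℝ)
    (hf : ∀ z : ℝ, z ≠ 0 → f z = k
      + (a * Real.tanh (z/4) + b * Real.tanh (z/4)^2 + c * Real.tanh (z/4)^3
        + d * Real.tanh (z/4)^4 + e * Real.tanh (z/4)^5)
      + (a * (Real.tanh (z/4))⁻¹ + b * (Real.tanh (z/4))⁻¹^2 + c * (Real.tanh (z/4))⁻¹^3
        + d * (Real.tanh (z/4))⁻¹^4 + e * (Real.tanh (z/4))⁻¹^5))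
    (z : ℝ) (hz : z ≠ 0) (U V : ℝ) (hU : U = Real.tanh (z/4)) (hV : V = (Real.tanh (z/4))⁻¹) :
    deriv f z = (a + 2*b*U + 3*c*U^2 + 4*d*U^3 + 5*e*U^4) * ((1 - U^2)/4)
      + (a + 2*b*V + 3*c*V^2 + 4*d*V^3 + 5*e*V^4) * ((1 - V^2)/4) := by
  subst hU hV
  have h1 := ks_poly_deriv _ z (ks_tanh_deriv z) a b c d e
  have h2 := ks_poly_deriv _ z (ks_coth_deriv z hz) a b c d e
  refine HasDerivAt.deriv (((h1.const_add k).add h2).congr_of_eventuallyEq ?_)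
  filter_upwards [isOpen_ne.mem_nhds hz] with x hx
  exact hf x hx

theorem ks_solitary_wave_12 (C₀ : ℝ) :
    let U : ℝ → ℝ := fun z => Real.tanh (z/4)
    let y : ℝ → ℝ := fun z =>
      C₀ + 3/2 - (15/8) * (U z + (U z)⁻¹) - (15/4) * ((U z)^2 + ((U z)^2)⁻¹)
        + (15/8) * ((U z)^3 + ((U z)^3)⁻¹)
    let C₁ : ℝ := (1/2) * C₀^2 - 18
    ∀ z : ℝ, z ≠ 0 →
      C₁ - C₀ * y z + deriv y z + 4 * deriv (deriv y) z
        + deriv (deriv (deriv y)) z + (1/2) * (y z)^2 = 0 := by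
  intro U y C₁ z hz
  have d1 := ks_sym_deriv (C₀ + 3/2) (-15/8) (-15/4) (15/8) 0 0 y
    (by intro x _; simp only [y, U, inv_pow]; ring)
  have d2 := ks_sym_deriv (-15/16) (-15/8) (15/8) (15/8) (-45/32) 0 (deriv y)
    (by intro x hx; rw [d1 x hx _ _ rfl rfl]; ring)
  have d3 := ks_sym_deriv (-15/16) (15/16) (15/8) (-75/32) (-45/32) (45/32) (deriv (deriv y))
    (by intro x hx; rw [d2 x hx _ _ rfl rfl]; ring)
  rw [d1 z hz _ _ rfl rfl, d2 z hz _ _ rfl rfl, d3 z hz _ _ rfl rfl]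
  have hne := ks_tanh_ne z hz
  simp only [y, U, C₁]
  generalize Real.tanh (z/4) = u at hne
  field_simp
  ring
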